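/- Let n ∈ ℕ satisfy W_n = { ⟨m, ⌜φ⌝⟩ : φ an 𝓛-formula with free variables ⊆ {x} and Σ(n) ⊨ φ(x|m̄) }. Then M_{Σ(n)} satisfies all the axioms of epistemic arithmetic mod factivity, and moreover satisfies all instances of E3, the universal closure of Kφ → φ; in particular M_{Σ(n)} satisfies all the axioms of epistemic arithmetic. -/

import Mathlib

/-!
Formalization of the framework of "A machine that knows its own code" (S. Alexander).

The language 𝓛 is the language of Peano arithmetic (constant `0`, unary successor `S`,
binary `+` and `·`) extended by a unary modal operator `K`.
-/

/-- Terms of the language 𝓛 of Peano arithmetic (variables are indexed by `ℕ`). -/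
inductive LTerm : Type
  | var : ℕ → LTerm
  | zero : LTerm
  | succ : LTerm → LTerm
  | add : LTerm → LTerm → LTerm
  | mul : LTerm → LTerm → LTerm
  deriving DecidableEq

/-- Formulas of 𝓛: atomic equalities, falsum, implication, universal quantification,
and the modal operator `K`.  Other connectives and `∃` are defined below. -/
inductive LFormula : Type
  | eq : LTerm → LTerm → LFormula
  | falsum : LFormula
  | imp : LFormula → LFormula → LFormula
  | all : ℕ → LFormula → LFormula
  | K : LFormula → LFormula
  deriving DecidableEq

namespace LTerm

/-- Variables occurring in a term. -/
def fv : LTerm → Finset ℕ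
  | var n => {n}
  | zero => ∅
  | succ t => t.fv
  | add t u => t.fv ∪ u.fv
  | mul t u => t.fv ∪ u.fv

/-- Simultaneous substitution of terms for variables in a term. -/
def subst (s : ℕ → LTerm) : LTerm → LTerm
  | var n => s n
  | zero => zero
  | succ t => succ (t.subst s)
  | add t u => add (t.subst s) (u.subst s)
  | mul t u => mul (t.subst s) (u.subst s)

end LTerm

/-- The numeral `n̄` for a natural number `n`. -/
def numeral : ℕ → LTerm
  | 0 => LTerm.zero
  | n + 1 => LTerm.succ (numeral n)

namespace LFormula

/-- The free variables of a formula (the free variables of `K φ` are those of `φ`). -/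
def fv : LFormula → Finset ℕ
  | eq t u => t.fv ∪ u.fv
  | falsum => ∅
  | imp a b => a.fv ∪ b.fv
  | all x a => a.fv.erase x
  | K a => a.fv

/-- Simultaneous substitution of terms for the *free* variables of a formula
(bound variables are left untouched; the substitution is not capture-avoiding). -/
def subst (s : ℕ → LTerm) : LFormula → LFormula
  | eq t u => eq (t.subst s) (u.subst s)
  | falsum => falsum
  | imp a b => imp (a.subst s) (b.subst s)
  | all x a => all x (a.subst fun z => if z = x then LTerm.var x else s z)
  | K a => K (a.subst s)

end LFormula

/-- `subst1 x t φ` is `φ(x|t)`, the result of substituting the term `t` for the free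
occurrences of the variable `x` in `φ`. -/
def subst1 (x : ℕ) (t : LTerm) (φ : LFormula) : LFormula :=
  φ.subst fun z => if z = x then t else LTerm.var z

/-- `instNum s φ` is `φ^s`: the sentence obtained from `φ` by replacing each free
variable `x` of `φ` by the numeral for `s x`. -/
def instNum (s : ℕ → ℕ) (φ : LFormula) : LFormula :=
  φ.subst fun z => numeral (s z)

/-- `SubstitutableVar y x φ`: the variable `y` is substitutable for the variable `x`
in `φ` (no free occurrence of `x` lies within the scope of a quantifier binding `y`). -/
def SubstitutableVar (y x : ℕ) : LFormula → Prop
  | .eq _ _ => True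
  | .falsum => True
  | .imp a b => SubstitutableVar y x a ∧ SubstitutableVar y x b
  | .all z a => x ∉ (LFormula.all z a).fv ∨ (y ≠ z ∧ SubstitutableVar y x a)
  | .K a => SubstitutableVar y x a

/-- Correspondence of variables relative to a list of pairs of bound variables. -/
def VarCorr : List (ℕ × ℕ) → ℕ → ℕ → Prop
  | [], x, y => x = y
  | (a, b) :: Γ, x, y => (x = a ∧ y = b) ∨ (x ≠ a ∧ y ≠ b ∧ VarCorr Γ x y)

/-- Alpha-correspondence of terms relative to a list of pairs of bound variables. -/
def TermAlpha (Γ : List (ℕ × ℕ)) : LTerm → LTerm → Prop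
  | .var x, .var y => VarCorr Γ x y
  | .zero, .zero => True
  | .succ t, .succ u => TermAlpha Γ t u
  | .add t₁ t₂, .add u₁ u₂ => TermAlpha Γ t₁ u₁ ∧ TermAlpha Γ t₂ u₂
  | .mul t₁ t₂, .mul u₁ u₂ => TermAlpha Γ t₁ u₁ ∧ TermAlpha Γ t₂ u₂
  | _, _ => False

/-- Alpha-correspondence of formulas relative to a list of pairs of bound variables. -/
def FormulaAlpha : List (ℕ × ℕ) → LFormula → LFormula → Prop
  | Γ, .eq t₁ t₂, .eq u₁ u₂ => TermAlpha Γ t₁ u₁ ∧ TermAlpha Γ t₂ u₂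
  | _, .falsum, .falsum => True
  | Γ, .imp a₁ a₂, .imp b₁ b₂ => FormulaAlpha Γ a₁ b₁ ∧ FormulaAlpha Γ a₂ b₂
  | Γ, .all x a, .all y b => FormulaAlpha ((x, y) :: Γ) a b
  | Γ, .K a, .K b => FormulaAlpha Γ a b
  | _, _, _ => False

/-- `ψ` is an alphabetic variant of `φ`: `ψ` is obtained from `φ` by renaming bound
variables so as to respect the binding of the quantifiers. -/
def AlphaVariant (φ ψ : LFormula) : Prop := FormulaAlpha [] φ ψ

/-- Negation, defined from `→` and `⊥`. -/
def notF (φ : LFormula) : LFormula := LFormula.imp φ LFormula.falsum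

/-- Conjunction (defined connective). -/
def andF (φ ψ : LFormula) : LFormula := notF (LFormula.imp φ (notF ψ))

/-- Biconditional (defined connective). -/
def iffF (φ ψ : LFormula) : LFormula := andF (LFormula.imp φ ψ) (LFormula.imp ψ φ)

/-- Existential quantification (defined). -/
def exF (x : ℕ) (φ : LFormula) : LFormula := notF (LFormula.all x (notF φ))

/-- A canonical universal closure of a formula. -/
def uclose (φ : LFormula) : LFormula :=
  (φ.fv.sort (· ≤ ·)).foldr LFormula.all φ

/-- An 𝓛-structure: a first-order structure for the first-order part of 𝓛, together
with a truth assignment `satK s φ` for the purely modal formulas `K φ` at each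
assignment `s` into the universe (the three required constraints are singled out
in `IsLStructure` below). -/
structure LStructure where
  U : Type
  nonempty : Nonempty U
  zero : U
  succ : U → U
  add : U → U → U
  mul : U → U → U
  satK : (ℕ → U) → LFormula → Prop

namespace LStructure

/-- Value of a term under an assignment. -/
def evalT (M : LStructure) (s : ℕ → M.U) : LTerm → M.U
  | .var n => s n
  | .zero => M.zero
  | .succ t => M.succ (M.evalT s t)
  | .add t u => M.add (M.evalT s t) (M.evalT s u)
  | .mul t u => M.mul (M.evalT s t) (M.evalT s u)

/-- Satisfaction `M ⊨ φ[s]`, defined by the usual induction on formula complexity,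
with `M ⊨ (K φ)[s]` given by the structure's truth assignment `satK`. -/
def Sat (M : LStructure) : (ℕ → M.U) → LFormula → Prop
  | s, .eq t u => M.evalT s t = M.evalT s u
  | _, .falsum => False
  | s, .imp a b => M.Sat s a → M.Sat s b
  | s, .all x a => ∀ u : M.U, M.Sat (Function.update s x u) a
  | s, .K a => M.satK s a

/-- `M ⊨ φ`: `M ⊨ φ[s]` for every assignment `s`. -/
def Models (M : LStructure) (φ : LFormula) : Prop := ∀ s : ℕ → M.U, M.Sat s φ

end LStructure

/-- The three constraints making an `LStructure` a genuine 𝓛-structure of the base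
logic: (a) `satK s φ` depends only on the values of `s` on the free variables of `φ`;
(b) invariance under alphabetic variants; (c) weak substitution. -/
def IsLStructure (M : LStructure) : Prop :=
  (∀ (φ : LFormula) (s t : ℕ → M.U), (∀ x ∈ φ.fv, s x = t x) →
      (M.satK s φ ↔ M.satK t φ)) ∧
  (∀ (φ ψ : LFormula) (s : ℕ → M.U), AlphaVariant φ ψ →
      (M.satK s φ ↔ M.satK s ψ)) ∧
  (∀ (φ : LFormula) (x y : ℕ) (s : ℕ → M.U), SubstitutableVar y x φ →
      (M.satK s (subst1 x (LTerm.var y) φ) ↔ M.satK (Function.update s x (s y)) φ))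

/-- `Σ ⊨ φ`: every 𝓛-structure satisfying every member of `Σ` satisfies `φ`. -/
def Consequence (T : Set LFormula) (φ : LFormula) : Prop :=
  ∀ M : LStructure, IsLStructure M → (∀ σ ∈ T, M.Models σ) → M.Models φ

/-- `φ` is valid: `∅ ⊨ φ`, i.e. `φ` holds in every 𝓛-structure under every assignment. -/
def Valid (φ : LFormula) : Prop := Consequence ∅ φ

/-- The structure `M_Σ`: universe `ℕ`, standard interpretations of the symbols of
Peano arithmetic, and `M_Σ ⊨ (K φ)[s]` iff `Σ ⊨ φ^s`. -/
def MSigma (T : Set LFormula) : LStructure where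
  U := ℕ
  nonempty := ⟨0⟩
  zero := 0
  succ := Nat.succ
  add := (· + ·)
  mul := (· * ·)
  satK := fun s φ => Consequence T (instNum s φ)

/-- Instances of the schema `E1`: the universal closure of `K φ` for valid `φ`. -/
def E1set : Set LFormula :=
  {χ | ∃ φ : LFormula, Valid φ ∧ χ = uclose (LFormula.K φ)}

/-- Instances of the schema `E2`: the universal closure of `K(φ → ψ) → K φ → K ψ`. -/
def E2set : Set LFormula :=
  {χ | ∃ φ ψ : LFormula,
    χ = uclose (LFormula.imp (LFormula.K (LFormula.imp φ ψ))
      (LFormula.imp (LFormula.K φ) (LFormula.K ψ)))}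

/-- Instances of the schema `E3` (factivity): the universal closure of `K φ → φ`. -/
def E3set : Set LFormula :=
  {χ | ∃ φ : LFormula, χ = uclose (LFormula.imp (LFormula.K φ) φ)}

/-- Instances of the schema `E4`: the universal closure of `K φ → K K φ`. -/
def E4set : Set LFormula :=
  {χ | ∃ φ : LFormula, χ = uclose (LFormula.imp (LFormula.K φ) (LFormula.K (LFormula.K φ)))}

/-- The axioms of Peano arithmetic for 𝓛: the six usual axioms for successor,
addition and multiplication, and the induction schema extended to all 𝓛-formulas. -/
inductive PAax : LFormula → Prop
  | succ_ne_zero : PAax (.all 0 (notF (.eq (.succ (.var 0)) .zero)))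
  | succ_inj : PAax (.all 0 (.all 1 (.imp (.eq (.succ (.var 0)) (.succ (.var 1)))
      (.eq (.var 0) (.var 1)))))
  | add_zero : PAax (.all 0 (.eq (.add (.var 0) .zero) (.var 0)))
  | add_succ : PAax (.all 0 (.all 1 (.eq (.add (.var 0) (.succ (.var 1)))
      (.succ (.add (.var 0) (.var 1))))))
  | mul_zero : PAax (.all 0 (.eq (.mul (.var 0) .zero) .zero))
  | mul_succ : PAax (.all 0 (.all 1 (.eq (.mul (.var 0) (.succ (.var 1)))
      (.add (.mul (.var 0) (.var 1)) (.var 0)))))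
  | ind (φ : LFormula) (x : ℕ) :
      PAax (uclose (.imp (subst1 x .zero φ)
        (.imp (.all x (.imp φ (subst1 x (.succ (.var x)) φ))) (.all x φ))))

/-- The set of axioms of Peano arithmetic for 𝓛. -/
def PAset : Set LFormula := {φ | PAax φ}

/-- `W e`: the `e`-th recursively enumerable subset of `ℕ` (the domain of the `e`-th
partial computable function). -/
def W (e : ℕ) : Set ℕ :=
  {m | ((Denumerable.ofNat Nat.Partrec.Code e).eval m).Dom}

namespace LTerm

/-- A canonical Gödel numbering of terms. -/
def gnum : LTerm → ℕ
  | var n => Nat.pair 0 n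
  | zero => Nat.pair 1 0
  | succ t => Nat.pair 2 t.gnum
  | add t u => Nat.pair 3 (Nat.pair t.gnum u.gnum)
  | mul t u => Nat.pair 4 (Nat.pair t.gnum u.gnum)

end LTerm

namespace LFormula

/-- A canonical Gödel numbering `⌜φ⌝` of formulas. -/
def gnum : LFormula → ℕ
  | eq t u => Nat.pair 0 (Nat.pair t.gnum u.gnum)
  | falsum => Nat.pair 1 0
  | imp a b => Nat.pair 2 (Nat.pair a.gnum b.gnum)
  | all x a => Nat.pair 3 (Nat.pair x a.gnum)
  | K a => Nat.pair 4 a.gnum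

end LFormula

/-- The designated variable `x`. -/
def vx : ℕ := 0
/-- The designated variable `y` (second pairing argument). -/
def vy : ℕ := 1
/-- The designated variable `e` (r.e. index). -/
def ve : ℕ := 2

/-- A formula is `K`-free (purely first-order) if the operator `K` does not occur in it. -/
def KFree : LFormula → Prop
  | .eq _ _ => True
  | .falsum => True
  | .imp a b => KFree a ∧ KFree b
  | .all _ a => KFree a
  | .K _ => False

/-- The standard structure: universe `ℕ` with the standard interpretations of the
symbols of Peano arithmetic (the modal component is irrelevant for `K`-free formulas). -/
def StdModel : LStructure where
  U := ℕ
  nonempty := ⟨0⟩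
  zero := 0
  succ := Nat.succ
  add := (· + ·)
  mul := (· * ·)
  satK := fun _ _ => False

/-- `pwNum pw a b k`: the result of substituting the numerals `ā`, `b̄`, `k̄` for the
designated variables `x`, `y`, `e` in the formula `pw` (read: `⟨ā, b̄⟩ ∈ W_k̄`). -/
def pwNum (pw : LFormula) (a b k : ℕ) : LFormula :=
  instNum (fun z => if z = vx then a else if z = vy then b else k) pw

/-- `wNum w a k`: the result of substituting the numerals `ā`, `k̄` for the designated
variables `x`, `e` in the formula `w` (read: `ā ∈ W_k̄`). -/
def wNum (w : LFormula) (a k : ℕ) : LFormula :=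
  instNum (fun z => if z = vx then a else k) w

/-- Line 3 of the definition of `Σ(n)`: the sentence
`∀x (K φ ↔ ⟨x, ⌜φ⌝⟩ ∈ W_n̄)`, where `pw` is the formula (with designated free
variables `x`, `y`, `e`) expressing `⟨x, y⟩ ∈ W_e`. -/
def line3 (pw : LFormula) (n : ℕ) (φ : LFormula) : LFormula :=
  LFormula.all vx (iffF (LFormula.K φ)
    (subst1 ve (numeral n) (subst1 vy (numeral φ.gnum) pw)))

/-- Membership in the axiom set `Σ(n)` (relative to the formula `pw` expressing
`⟨x, y⟩ ∈ W_e`): (1) instances of `E1`, `E2`, `E4`; (2) the axioms of Peano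
arithmetic for 𝓛; (3) `∀x (K φ ↔ ⟨x, ⌜φ⌝⟩ ∈ W_n̄)` for `φ` with free variables
⊆ {x}; (4) assigned validity `φ^s` for valid `φ`; (5) `K φ` for `φ` an instance of
lines 1–4 or, recursively, of line 5. -/
inductive SigmaAx (pw : LFormula) (n : ℕ) : LFormula → Prop
  | e1 {χ : LFormula} (h : χ ∈ E1set) : SigmaAx pw n χ
  | e2 {χ : LFormula} (h : χ ∈ E2set) : SigmaAx pw n χ
  | e4 {χ : LFormula} (h : χ ∈ E4set) : SigmaAx pw n χ
  | pa {χ : LFormula} (h : PAax χ) : SigmaAx pw n χ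
  | code (φ : LFormula) (h : φ.fv ⊆ {vx}) : SigmaAx pw n (line3 pw n φ)
  | av (φ : LFormula) (s : ℕ → ℕ) (h : Valid φ) : SigmaAx pw n (instNum s φ)
  | k {φ : LFormula} (h : SigmaAx pw n φ) : SigmaAx pw n (LFormula.K φ)

/-- The axiom set `Σ(n)` (relative to `pw`). -/
def SigmaN (pw : LFormula) (n : ℕ) : Set LFormula := {φ | SigmaAx pw n φ}

/-- The set `{ ⟨m, ⌜φ⌝⟩ : φ an 𝓛-formula with free variables ⊆ {x} and
Σ(n) ⊨ φ(x|m̄) }`. -/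
def goalSet (pw : LFormula) (n : ℕ) : Set ℕ :=
  {p | ∃ (m : ℕ) (φ : LFormula), p = Nat.pair m φ.gnum ∧ φ.fv ⊆ {vx} ∧
    Consequence (SigmaN pw n) (subst1 vx (numeral m) φ)}

/-- The axioms of epistemic arithmetic mod factivity: the pre-closure axioms of
knowledge (E1, E2, E3, E4) together with `K φ` whenever φ is an instance of E1, E2,
E4, or an axiom of Peano arithmetic for 𝓛. -/
def EAmodFact : Set LFormula :=
  (E1set ∪ E2set ∪ E3set ∪ E4set) ∪
    (LFormula.K '' (E1set ∪ E2set ∪ E4set ∪ PAset))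

namespace LTerm

theorem subst_congr {σ τ : ℕ → LTerm} :
    ∀ {t : LTerm}, (∀ z ∈ t.fv, σ z = τ z) → t.subst σ = t.subst τ
  | var _, h => h _ (by simp [fv])
  | zero, _ => rfl
  | succ _, h => congrArg succ (subst_congr h)
  | add _ _, h => congrArg₂ add (subst_congr fun z hz => h z (by simp [fv, hz]))
      (subst_congr fun z hz => h z (by simp [fv, hz]))
  | mul _ _, h => congrArg₂ mul (subst_congr fun z hz => h z (by simp [fv, hz]))
      (subst_congr fun z hz => h z (by simp [fv, hz]))

theorem subst_var (t : LTerm) : t.subst var = t := by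
  induction t <;> simp_all [subst]

theorem subst_subst (σ τ : ℕ → LTerm) (t : LTerm) :
    (t.subst σ).subst τ = t.subst fun z => (σ z).subst τ := by
  induction t <;> simp_all [subst]

theorem mem_fv_subst {σ : ℕ → LTerm} {w : ℕ} {t : LTerm} :
    w ∈ (t.subst σ).fv ↔ ∃ z ∈ t.fv, w ∈ (σ z).fv := by
  induction t <;> simp_all [subst, fv, or_and_right, exists_or]

theorem gnum_injective : Function.Injective gnum := by
  intro t
  induction t with
  | var n => intro u; cases u <;> simp [gnum]
  | zero => intro u; cases u <;> simp [gnum]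
  | succ t ih => intro u; cases u <;> simp [gnum]; exact fun h => ih h
  | add t v iht ihv =>
    intro u; cases u <;> simp [gnum]; exact fun h h' => ⟨iht h, ihv h'⟩
  | mul t v iht ihv =>
    intro u; cases u <;> simp [gnum]; exact fun h h' => ⟨iht h, ihv h'⟩

end LTerm

theorem fv_numeral (n : ℕ) : (numeral n).fv = ∅ := by
  induction n <;> simp_all [numeral, LTerm.fv]

theorem subst_numeral (σ : ℕ → LTerm) (n : ℕ) : (numeral n).subst σ = numeral n := by
  induction n <;> simp_all [numeral, LTerm.subst]

namespace LFormula

theorem gnum_injective : Function.Injective gnum := by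
  intro a
  induction a with
  | eq t u =>
    intro b; cases b <;> simp [gnum]
    exact fun h h' => ⟨LTerm.gnum_injective h, LTerm.gnum_injective h'⟩
  | falsum => intro b; cases b <;> simp [gnum]
  | imp a c iha ihc =>
    intro b; cases b <;> simp [gnum]; exact fun h h' => ⟨iha h, ihc h'⟩
  | all x a ih => intro b; cases b <;> simp [gnum]; exact fun h h' => ⟨h, ih h'⟩
  | K a ih => intro b; cases b <;> simp [gnum]; exact fun h => ih h

/-- The variables bound by some quantifier of a formula. -/
def bv : LFormula → Finset ℕ
  | eq _ _ => ∅
  | falsum => ∅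
  | imp a b => a.bv ∪ b.bv
  | all x a => insert x a.bv
  | K a => a.bv

/-- No variable of the terms `σ z` is captured when `σ` is substituted into the formula. -/
def FreeFor : (ℕ → LTerm) → LFormula → Prop
  | _, eq _ _ => True
  | _, falsum => True
  | σ, imp a b => FreeFor σ a ∧ FreeFor σ b
  | σ, all x a => (∀ z ∈ a.fv, z ≠ x → x ∉ (σ z).fv) ∧
      FreeFor (fun z => if z = x then LTerm.var x else σ z) a
  | σ, K a => FreeFor σ a

theorem subst_congr {a : LFormula} :
    ∀ {σ τ : ℕ → LTerm}, (∀ z ∈ a.fv, σ z = τ z) → a.subst σ = a.subst τ := by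
  induction a with
  | eq t u =>
    intro σ τ h
    exact congrArg₂ eq (LTerm.subst_congr fun z hz => h z (by simp [fv, hz]))
      (LTerm.subst_congr fun z hz => h z (by simp [fv, hz]))
  | falsum => intros; rfl
  | imp a b iha ihb =>
    intro σ τ h
    exact congrArg₂ imp (iha fun z hz => h z (by simp [fv, hz]))
      (ihb fun z hz => h z (by simp [fv, hz]))
  | all x a ih =>
    intro σ τ h
    refine congrArg (all x) (ih fun z hz => ?_)
    split_ifs with hzx
    · rfl
    · exact h z (by simp [fv, hz, hzx])
  | K a ih => intro σ τ h; exact congrArg K (ih h)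

theorem subst_var (a : LFormula) : a.subst LTerm.var = a := by
  induction a with
  | all x a ih =>
    have : (fun z => if z = x then LTerm.var x else LTerm.var z) = LTerm.var := by
      funext z; split_ifs with h <;> simp [h]
    simp [subst, this, ih]
  | _ => simp_all [subst, LTerm.subst_var]

theorem subst_eq_self {a : LFormula} {σ : ℕ → LTerm} (h : ∀ z ∈ a.fv, σ z = LTerm.var z) :
    a.subst σ = a :=
  (subst_congr h).trans a.subst_var

theorem bv_subst {a : LFormula} : ∀ σ : ℕ → LTerm, (a.subst σ).bv = a.bv := by
  induction a <;> simp_all [subst, bv]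

theorem FreeFor.congr {a : LFormula} : ∀ {σ τ : ℕ → LTerm}, (∀ z ∈ a.fv, σ z = τ z) →
    FreeFor σ a → FreeFor τ a := by
  induction a with
  | eq t u => intros; trivial
  | falsum => intros; trivial
  | imp a b iha ihb =>
    intro σ τ h hσ
    exact ⟨iha (fun z hz => h z (by simp [fv, hz])) hσ.1,
      ihb (fun z hz => h z (by simp [fv, hz])) hσ.2⟩
  | all x a ih =>
    intro σ τ h hσ
    refine ⟨fun z hz hzx => ?_, ih (fun z hz => ?_) hσ.2⟩
    · rw [← h z (by simp [fv, hz, hzx])]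
      exact hσ.1 z hz hzx
    · split_ifs with hzx
      · rfl
      · exact h z (by simp [fv, hz, hzx])
  | K a ih => intro σ τ h hσ; exact ih h hσ

theorem freeFor_of_forall {a : LFormula} : ∀ {σ : ℕ → LTerm},
    (∀ z ∈ a.fv, ∀ w ∈ (σ z).fv, w = z ∨ w ∉ a.bv) → FreeFor σ a := by
  induction a with
  | eq t u => intros; trivial
  | falsum => intros; trivial
  | imp a b iha ihb =>
    intro σ h
    constructor
    · refine iha fun z hz w hw => (h z (by simp [fv, hz]) w hw).imp_right ?_
      simp +contextual [bv]
    · refine ihb fun z hz w hw => (h z (by simp [fv, hz]) w hw).imp_right ?_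
      simp +contextual [bv]
  | all x a ih =>
    intro σ h
    refine ⟨fun z hz hzx hx => ?_, ih fun z hz w hw => ?_⟩
    · rcases h z (by simp [fv, hz, hzx]) x hx with h | h
      · exact hzx h.symm
      · simp [bv] at h
    · split_ifs at hw with hzx
      · subst hzx
        left
        simpa [LTerm.fv] using hw
      · refine (h z (by simp [fv, hz, hzx]) w hw).imp_right ?_
        simp +contextual [bv]
  | K a ih => intro σ h; exact ih h

theorem subst_subst {a : LFormula} : ∀ {σ : ℕ → LTerm} (τ : ℕ → LTerm), FreeFor σ a →
    (a.subst σ).subst τ = a.subst fun z => (σ z).subst τ := by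
  induction a with
  | eq t u => intros; simp [subst, LTerm.subst_subst]
  | falsum => intros; rfl
  | imp a b iha ihb => intro σ τ h; simp [subst, iha τ h.1, ihb τ h.2]
  | all x a ih =>
    intro σ τ h
    simp only [subst, ih _ h.2, all.injEq, true_and]
    refine subst_congr fun z hz => ?_
    split_ifs with hzx
    · simp [LTerm.subst]
    · refine LTerm.subst_congr fun w hw => if_neg ?_
      rintro rfl
      exact h.1 z hz hzx hw
  | K a ih => intro σ τ h; simp [subst, ih τ h]

theorem mem_fv_of_mem_fv_subst {a : LFormula} : ∀ {σ : ℕ → LTerm} {w : ℕ},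
    w ∈ (a.subst σ).fv → ∃ z ∈ a.fv, w ∈ (σ z).fv := by
  induction a with
  | eq t u =>
    intro σ w h
    simp only [subst, fv, Finset.mem_union, LTerm.mem_fv_subst] at h ⊢
    grind
  | falsum => intro σ w h; simp [subst, fv] at h
  | imp a b iha ihb =>
    intro σ w h
    simp only [subst, fv, Finset.mem_union] at h ⊢
    grind
  | all x a ih =>
    intro σ w h
    simp only [subst, fv, Finset.mem_erase] at h ⊢
    obtain ⟨z, hz, hw⟩ := ih h.2
    split_ifs at hw with hzx
    · simp [LTerm.fv, h.1] at hw
    · exact ⟨z, ⟨hzx, hz⟩, hw⟩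
  | K a ih => intro σ w h; exact ih h

end LFormula

theorem SubstitutableVar.freeFor {x y : ℕ} {a : LFormula} : SubstitutableVar y x a →
    a.FreeFor fun z => if z = x then LTerm.var y else LTerm.var z := by
  induction a with
  | eq t u => intros; trivial
  | falsum => intros; trivial
  | imp a b iha ihb => exact fun h => ⟨iha h.1, ihb h.2⟩
  | all w a ih =>
    intro h
    by_cases hx : x ∈ (LFormula.all w a).fv
    · obtain ⟨hyw, h⟩ := h.resolve_left (not_not_intro hx)
      have hxw : x ≠ w := (Finset.mem_erase.1 hx).1
      refine ⟨fun z hz hzw => ?_, (ih h).congr fun z hz => ?_⟩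
      · beta_reduce
        split_ifs <;> simp [LTerm.fv, Ne.symm hyw, Ne.symm hzw]
      · by_cases hzw : z = w
        · subst hzw
          simp [Ne.symm hxw]
        · simp [hzw]
    · refine LFormula.FreeFor.congr (σ := LTerm.var) (fun z hz => ?_)
        (LFormula.freeFor_of_forall fun z _ v hv => Or.inl (by simpa [LTerm.fv] using hv))
      rw [if_neg]
      rintro rfl
      exact hx hz
  | K a ih => exact fun h => ih h

theorem substitutableVar_of_notMem_bv {x y : ℕ} {a : LFormula} (h : y ∉ a.bv) :
    SubstitutableVar y x a := by
  induction a <;> simp_all [LFormula.bv, SubstitutableVar]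

theorem VarCorr.left_unique : ∀ {Γ : List (ℕ × ℕ)} {x x' y : ℕ},
    VarCorr Γ x y → VarCorr Γ x' y → x = x'
  | [], _, _, _, h, h' => h.trans h'.symm
  | (_, _) :: _, _, _, _, .inl h, .inl h' => h.1.trans h'.1.symm
  | (_, _) :: _, _, _, _, .inl h, .inr h' => absurd h.2 h'.2.1
  | (_, _) :: _, _, _, _, .inr h, .inl h' => absurd h'.2 h.2.1
  | (_, _) :: _, _, _, _, .inr h, .inr h' => left_unique h.2.2 h'.2.2

theorem TermAlpha.exists_varCorr {Γ : List (ℕ × ℕ)} : ∀ {t u : LTerm}, TermAlpha Γ t u →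
    ∀ y ∈ u.fv, ∃ x ∈ t.fv, VarCorr Γ x y := by
  intro t
  induction t with
  | var x => intro u h; cases u <;> simp_all [TermAlpha, LTerm.fv]
  | zero => intro u h; cases u <;> simp_all [TermAlpha, LTerm.fv]
  | succ t ih => intro u h; cases u <;> simp only [TermAlpha, LTerm.fv] at *; exact ih h
  | add t v iht ihv =>
    intro u h; cases u <;> simp only [TermAlpha, LTerm.fv, Finset.mem_union] at *; grind
  | mul t v iht ihv =>
    intro u h; cases u <;> simp only [TermAlpha, LTerm.fv, Finset.mem_union] at *; grind

theorem FormulaAlpha.exists_varCorr {a : LFormula} : ∀ {Γ : List (ℕ × ℕ)} {b : LFormula},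
    FormulaAlpha Γ a b → ∀ y ∈ b.fv, ∃ x ∈ a.fv, VarCorr Γ x y := by
  induction a with
  | eq t u =>
    intro Γ b h y hy
    cases b <;> simp only [FormulaAlpha, LFormula.fv, Finset.mem_union] at *
    rcases hy with hy | hy
    · obtain ⟨x, hx, hxy⟩ := h.1.exists_varCorr y hy
      exact ⟨x, .inl hx, hxy⟩
    · obtain ⟨x, hx, hxy⟩ := h.2.exists_varCorr y hy
      exact ⟨x, .inr hx, hxy⟩
  | falsum => intro Γ b h; cases b <;> simp_all [FormulaAlpha, LFormula.fv]
  | imp a c iha ihc =>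
    intro Γ b h y hy
    cases b <;> simp only [FormulaAlpha, LFormula.fv, Finset.mem_union] at *
    rcases hy with hy | hy
    · obtain ⟨x, hx, hxy⟩ := iha h.1 y hy
      exact ⟨x, .inl hx, hxy⟩
    · obtain ⟨x, hx, hxy⟩ := ihc h.2 y hy
      exact ⟨x, .inr hx, hxy⟩
  | all v a ih =>
    intro Γ b h y hy
    cases b <;> simp only [FormulaAlpha, LFormula.fv, Finset.mem_erase] at *
    obtain ⟨x, hx, ⟨-, hxy⟩ | ⟨hxv, -, hxy⟩⟩ := ih h y hy.2
    · exact absurd hxy hy.1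
    · exact ⟨x, ⟨hxv, hx⟩, hxy⟩
  | K a ih => intro Γ b h; cases b <;> simp only [FormulaAlpha, LFormula.fv] at *; exact ih h

theorem TermAlpha.cons {Γ : List (ℕ × ℕ)} {x y : ℕ} : ∀ {t u : LTerm}, TermAlpha Γ t u →
    x ∉ t.fv → y ∉ u.fv → TermAlpha ((x, y) :: Γ) t u := by
  intro t
  induction t with
  | var x =>
    intro u h; cases u <;> simp_all [TermAlpha, LTerm.fv, VarCorr]
    grind
  | _ => intro u h; cases u <;> simp_all [TermAlpha, LTerm.fv]

theorem TermAlpha.subst {Γ Δ : List (ℕ × ℕ)} {σ τ : ℕ → LTerm} : ∀ {t u : LTerm},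
    TermAlpha Γ t u →
    (∀ x ∈ t.fv, ∀ y ∈ u.fv, VarCorr Γ x y → TermAlpha Δ (σ x) (τ y)) →
    TermAlpha Δ (t.subst σ) (u.subst τ) := by
  intro t
  induction t with
  | var x => intro u h; cases u <;> simp_all [TermAlpha, LTerm.fv, LTerm.subst]
  | zero => intro u h; cases u <;> simp_all [TermAlpha, LTerm.subst]
  | succ t ih => intro u h; cases u <;> simp_all [TermAlpha, LTerm.fv, LTerm.subst]
  | add t v iht ihv =>
    intro u h hc
    cases u <;> simp only [TermAlpha, LTerm.fv, LTerm.subst, Finset.mem_union] at *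
    exact ⟨iht h.1 fun x hx y hy => hc x (.inl hx) y (.inl hy),
      ihv h.2 fun x hx y hy => hc x (.inr hx) y (.inr hy)⟩
  | mul t v iht ihv =>
    intro u h hc
    cases u <;> simp only [TermAlpha, LTerm.fv, LTerm.subst, Finset.mem_union] at *
    exact ⟨iht h.1 fun x hx y hy => hc x (.inl hx) y (.inl hy),
      ihv h.2 fun x hx y hy => hc x (.inr hx) y (.inr hy)⟩

theorem FormulaAlpha.subst {a : LFormula} : ∀ {Γ Δ : List (ℕ × ℕ)} {σ τ : ℕ → LTerm}
    {b : LFormula}, FormulaAlpha Γ a b → a.FreeFor σ → b.FreeFor τ →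
    (∀ x ∈ a.fv, ∀ y ∈ b.fv, VarCorr Γ x y → TermAlpha Δ (σ x) (τ y)) →
    FormulaAlpha Δ (a.subst σ) (b.subst τ) := by
  induction a with
  | eq t u =>
    intro Γ Δ σ τ b h _ _ hc
    cases b <;> simp only [FormulaAlpha, LFormula.fv, LFormula.subst, Finset.mem_union] at *
    exact ⟨h.1.subst fun x hx y hy => hc x (.inl hx) y (.inl hy),
      h.2.subst fun x hx y hy => hc x (.inr hx) y (.inr hy)⟩
  | falsum => intro Γ Δ σ τ b h; cases b <;> simp_all [FormulaAlpha, LFormula.subst]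
  | imp a c iha ihc =>
    intro Γ Δ σ τ b h hσ hτ hc
    cases b <;> simp only [FormulaAlpha, LFormula.fv, LFormula.subst, Finset.mem_union] at *
    exact ⟨iha h.1 hσ.1 hτ.1 fun x hx y hy => hc x (.inl hx) y (.inl hy),
      ihc h.2 hσ.2 hτ.2 fun x hx y hy => hc x (.inr hx) y (.inr hy)⟩
  | all v a ih =>
    intro Γ Δ σ τ b h hσ hτ hc
    cases b <;> simp only [FormulaAlpha, LFormula.fv, LFormula.subst, Finset.mem_erase] at *
    refine ih h hσ.2 hτ.2 ?_
    rintro x hx y hy (⟨rfl, rfl⟩ | ⟨hxv, hyw, hxy⟩)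
    · simp [TermAlpha, VarCorr]
    · rw [if_neg hxv, if_neg hyw]
      exact (hc x ⟨hxv, hx⟩ y ⟨hyw, hy⟩ hxy).cons (hσ.1 x hx hxv) (hτ.1 y hy hyw)
  | K a ih =>
    intro Γ Δ σ τ b h hσ hτ hc
    cases b <;> simp only [FormulaAlpha, LFormula.fv, LFormula.subst] at *
    exact ih h hσ hτ hc

theorem termAlpha_of_fv_eq_empty {Γ : List (ℕ × ℕ)} {t : LTerm} (h : t.fv = ∅) :
    TermAlpha Γ t t := by
  induction t <;> simp_all [LTerm.fv, TermAlpha, Finset.union_eq_empty]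

namespace LStructure

variable {M : LStructure}

theorem evalT_congr {s t : ℕ → M.U} :
    ∀ {u : LTerm}, (∀ x ∈ u.fv, s x = t x) → M.evalT s u = M.evalT t u := by
  intro u
  induction u with
  | var x => intro h; exact h x (by simp [LTerm.fv])
  | _ => intro h; simp_all [LTerm.fv, evalT]

theorem sat_congr (hM : IsLStructure M) {a : LFormula} : ∀ {s t : ℕ → M.U},
    (∀ x ∈ a.fv, s x = t x) → (M.Sat s a ↔ M.Sat t a) := by
  induction a with
  | eq u v =>
    intro s t h
    simp only [LFormula.fv, Finset.mem_union] at h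
    simp only [Sat, evalT_congr fun x hx => h x (.inl hx), evalT_congr fun x hx => h x (.inr hx)]
  | falsum => intros; rfl
  | imp a b iha ihb =>
    intro s t h
    simp only [LFormula.fv, Finset.mem_union] at h
    exact imp_congr (iha fun x hx => h x (.inl hx)) (ihb fun x hx => h x (.inr hx))
  | all x a ih =>
    intro s t h
    refine forall_congr' fun u => ih fun z hz => ?_
    by_cases hzx : z = x
    · simp [hzx]
    · simp [hzx, h z (by simp [LFormula.fv, hz, hzx])]
  | K a ih => intro s t h; exact hM.1 a s t h

theorem models_all {x : ℕ} {a : LFormula} : M.Models (.all x a) ↔ M.Models a :=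
  ⟨fun h s => by simpa using h s (s x), fun h s u => h _⟩

theorem models_uclose {a : LFormula} : M.Models (uclose a) ↔ M.Models a := by
  unfold uclose
  induction a.fv.sort (· ≤ ·) with
  | nil => rfl
  | cons x l ih => exact models_all.trans ih

theorem evalT_eq_of_termAlpha {Γ : List (ℕ × ℕ)} {s t : ℕ → M.U} : ∀ {u v : LTerm},
    TermAlpha Γ u v → (∀ x y, VarCorr Γ x y → x ∈ u.fv → s x = t y) →
    M.evalT s u = M.evalT t v := by
  intro u
  induction u with
  | var x =>
    intro v h hc
    cases v <;> simp only [TermAlpha, LTerm.fv, Finset.mem_singleton, evalT] at *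
    exact hc x _ h rfl
  | zero => intro v h hc; cases v <;> simp_all [TermAlpha, evalT]
  | succ u ih =>
    intro v h hc
    cases v <;> simp only [TermAlpha, LTerm.fv, evalT] at *
    exact congrArg M.succ (ih h hc)
  | add u u' ih ih' =>
    intro v h hc
    cases v <;> simp only [TermAlpha, LTerm.fv, Finset.mem_union, evalT] at *
    exact congrArg₂ M.add (ih h.1 fun x y hxy hx => hc x y hxy (.inl hx))
      (ih' h.2 fun x y hxy hx => hc x y hxy (.inr hx))
  | mul u u' ih ih' =>
    intro v h hc
    cases v <;> simp only [TermAlpha, LTerm.fv, Finset.mem_union, evalT] at *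
    exact congrArg₂ M.mul (ih h.1 fun x y hxy hx => hc x y hxy (.inl hx))
      (ih' h.2 fun x y hxy hx => hc x y hxy (.inr hx))

/-- Renaming the free variables to variables not occurring in the formula. -/
theorem satK_rename (hM : IsLStructure M) {a : LFormula} {ρ : ℕ → ℕ}
    (hfv : ∀ z, ρ z ∉ a.fv) (hbv : ∀ z, ρ z ∉ a.bv) (s : ℕ → M.U) :
    M.satK s (a.subst fun z => LTerm.var (ρ z)) ↔ M.satK (fun z => s (ρ z)) a := by
  have key : ∀ F : Finset ℕ, F ⊆ a.fv → ∀ s : ℕ → M.U,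
      (M.satK s (a.subst fun z => if z ∈ F then LTerm.var (ρ z) else LTerm.var z) ↔
        M.satK (fun z => if z ∈ F then s (ρ z) else s z) a) := by
    intro F
    induction F using Finset.induction_on with
    | empty =>
      intro _ s
      simp [LFormula.subst_eq_self]
    | insert x F hx ih =>
      intro hF s
      have hxa : x ∈ a.fv := hF (Finset.mem_insert_self _ _)
      have hρx : ∀ z, ρ z ≠ x := fun z h => hfv z (h ▸ hxa)
      have hfree : a.FreeFor fun z => if z ∈ F then LTerm.var (ρ z) else LTerm.var z := by
        refine LFormula.freeFor_of_forall fun z _ w hw => ?_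
        split_ifs at hw
        · simp only [LTerm.fv, Finset.mem_singleton] at hw
          exact .inr (hw ▸ hbv z)
        · exact .inl (by simpa [LTerm.fv] using hw)
      have hsub : a.subst (fun z => if z ∈ insert x F then LTerm.var (ρ z) else LTerm.var z) =
          subst1 x (LTerm.var (ρ x))
            (a.subst fun z => if z ∈ F then LTerm.var (ρ z) else LTerm.var z) := by
        rw [subst1, LFormula.subst_subst _ hfree]
        refine LFormula.subst_congr fun z hz => ?_
        by_cases hzF : z ∈ F
        · simp [hzF, LTerm.subst, hρx]
        · by_cases hzx : z = x <;> simp [hzF, hzx, hx, LTerm.subst]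
      rw [hsub, hM.2.2 _ _ _ _ (substitutableVar_of_notMem_bv (by
        rw [LFormula.bv_subst]; exact hbv x)),
        ih ((Finset.subset_insert _ _).trans hF)]
      refine iff_of_eq (congrArg (M.satK · a) (funext fun z => ?_))
      by_cases hzF : z ∈ F
      · simp [hzF, hρx]
      · by_cases hzx : z = x
        · simp [hzx, hx]
        · simp [hzF, hzx]
  have h := key a.fv subset_rfl s
  rw [LFormula.subst_congr (τ := fun z => LTerm.var (ρ z)) fun z hz => if_pos hz] at h
  exact h.trans (hM.1 a _ _ fun z hz => if_pos hz)

theorem sat_iff_of_formulaAlpha (hM : IsLStructure M) {a : LFormula} :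
    ∀ {Γ : List (ℕ × ℕ)} {b : LFormula} {s t : ℕ → M.U}, FormulaAlpha Γ a b →
    (∀ x y, VarCorr Γ x y → x ∈ a.fv → s x = t y) → (M.Sat s a ↔ M.Sat t b) := by
  induction a with
  | eq t u =>
    intro Γ b s t h hc
    cases b <;> simp only [FormulaAlpha, LFormula.fv, Finset.mem_union, Sat] at *
    rw [evalT_eq_of_termAlpha h.1 fun x y hxy hx => hc x y hxy (.inl hx),
      evalT_eq_of_termAlpha h.2 fun x y hxy hx => hc x y hxy (.inr hx)]
  | falsum => intro Γ b s t h; cases b <;> simp_all [FormulaAlpha, Sat]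
  | imp a c iha ihc =>
    intro Γ b s t h hc
    cases b <;> simp only [FormulaAlpha, LFormula.fv, Finset.mem_union, Sat] at *
    exact imp_congr (iha h.1 fun x y hxy hx => hc x y hxy (.inl hx))
      (ihc h.2 fun x y hxy hx => hc x y hxy (.inr hx))
  | all v a ih =>
    intro Γ b s t h hc
    cases b <;> simp only [FormulaAlpha, LFormula.fv, Finset.mem_erase, Sat] at *
    refine forall_congr' fun u => ih h ?_
    rintro x y (⟨rfl, rfl⟩ | ⟨hxv, hyw, hxy⟩) hx
    · simp
    · simp [hxv, hyw, hc x y hxy ⟨hxv, hx⟩]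
  | K a ih =>
    intro Γ b s t h hc
    cases b <;> simp only [FormulaAlpha, LFormula.fv, Sat] at *
    rename_i b
    classical
    obtain ⟨N, hN⟩ : ∃ N, ∀ z ∈ a.fv ∪ a.bv ∪ (b.fv ∪ b.bv), z < N :=
      ⟨_, fun z hz => Nat.lt_succ_of_le (Finset.le_sup (f := id) hz)⟩
    simp only [Finset.mem_union] at hN
    have hN' : ∀ F : Finset ℕ, (∀ z ∈ F, z < N) → ∀ x, N + x ∉ F := fun F hF x hx => by
      have := hF _ hx
      omega
    let ρ : ℕ → ℕ := fun y => N + if h : ∃ x, VarCorr Γ x y then h.choose else y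
    have hρ : ∀ {x y}, VarCorr Γ x y → ρ y = N + x := fun {x y} hxy => by
      have hex : ∃ x, VarCorr Γ x y := ⟨x, hxy⟩
      simp only [ρ, dif_pos hex, hex.choose_spec.left_unique hxy]
    have hfree : ∀ (c : LFormula) (π : ℕ → ℕ), (∀ z, π z ∉ c.bv) →
        c.FreeFor fun z => LTerm.var (π z) := fun c π hc =>
      LFormula.freeFor_of_forall fun z _ w hw => by
        simp only [LTerm.fv, Finset.mem_singleton] at hw
        exact .inr (hw ▸ hc z)
    have hafv := hN' a.fv fun z hz => hN z (by tauto)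
    have habv := hN' a.bv fun z hz => hN z (by tauto)
    have hbfv : ∀ z, ρ z ∉ b.fv := fun z => hN' b.fv (fun z hz => hN z (by tauto)) _
    have hbbv : ∀ z, ρ z ∉ b.bv := fun z => hN' b.bv (fun z hz => hN z (by tauto)) _
    have halpha : AlphaVariant (a.subst fun z => LTerm.var (N + z))
        (b.subst fun z => LTerm.var (ρ z)) :=
      h.subst (hfree a _ habv) (hfree b _ hbbv) fun x _ y _ hxy => by
        simp [TermAlpha, VarCorr, hρ hxy]
    have hK := hM.2.1 _ _ (fun z => s (z - N)) halpha
    rw [satK_rename hM hafv habv, satK_rename hM hbfv hbbv] at hK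
    simp only [Nat.add_sub_cancel_left] at hK
    refine hK.trans (hM.1 b _ _ fun y hy => ?_)
    obtain ⟨x, hx, hxy⟩ := h.exists_varCorr y hy
    simp [hρ hxy, hc x y hxy hx]

section Ultraproduct

variable {ι : Type} (l : Ultrafilter ι) (N : ι → LStructure)

/-- The ultraproduct of a family of 𝓛-structures; the formulas `K φ` are evaluated on
representatives. -/
noncomputable def ultraproduct : LStructure where
  U := Quotient ((l : Filter ι).productSetoid fun i => (N i).U)
  nonempty := ⟨Quotient.mk _ fun i => (N i).zero⟩
  zero := Quotient.mk _ fun i => (N i).zero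
  succ u := Quotient.mk _ fun i => (N i).succ (u.out i)
  add u v := Quotient.mk _ fun i => (N i).add (u.out i) (v.out i)
  mul u v := Quotient.mk _ fun i => (N i).mul (u.out i) (v.out i)
  satK s φ := ∀ᶠ i in l, (N i).satK (fun z => (s z).out i) φ

variable {N}

/-- The class of a family of elements in the ultraproduct. -/
def ultraproductMk (f : ∀ i, (N i).U) : (ultraproduct l N).U :=
  Quotient.mk ((l : Filter ι).productSetoid fun i => (N i).U) f

/-- A family of elements representing an element of the ultraproduct. -/
noncomputable def ultraproductOut {l : Ultrafilter ι} (u : (ultraproduct l N).U) (i : ι) :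
    (N i).U :=
  Quotient.out (s := (l : Filter ι).productSetoid fun i => (N i).U) u i

theorem out_mk_eventuallyEq (f : ∀ i, (N i).U) :
    ∀ᶠ i in l, ultraproductOut (ultraproductMk l f) i = f i :=
  Quotient.exact (s := (l : Filter ι).productSetoid fun i => (N i).U)
    (Quotient.out_eq (Quotient.mk _ f))

theorem out_update (s : ℕ → (ultraproduct l N).U) (x : ℕ) (u : (ultraproduct l N).U) (i : ι) :
    (fun z => ultraproductOut (Function.update s x u z) i) =
      Function.update (fun z => ultraproductOut (s z) i) x (ultraproductOut u i) := by
  funext z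
  by_cases h : z = x
  · subst h; simp
  · simp [h]

theorem isLStructure_ultraproduct (hN : ∀ i, IsLStructure (N i)) :
    IsLStructure (ultraproduct l N) := by
  refine ⟨fun φ s t h => ?_, fun φ ψ s h => ?_, fun φ x y s h => ?_⟩
  · exact Filter.eventually_congr (.of_forall fun i =>
      (hN i).1 φ _ _ fun x hx => congrArg (ultraproductOut · i) (h x hx))
  · exact Filter.eventually_congr (.of_forall fun i => (hN i).2.1 φ ψ _ h)
  · refine Filter.eventually_congr (.of_forall fun i => ?_)
    have := (hN i).2.2 φ x y (fun z => ultraproductOut (s z) i) h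
    rw [← out_update l s x (s y)] at this
    exact this

theorem out_evalT_ultraproduct (s : ℕ → (ultraproduct l N).U) (t : LTerm) :
    ∀ᶠ i in l, ultraproductOut ((ultraproduct l N).evalT s t) i =
      (N i).evalT (fun z => ultraproductOut (s z) i) t := by
  induction t with
  | var x => exact .of_forall fun i => rfl
  | zero => exact out_mk_eventuallyEq l _
  | succ t ih =>
    filter_upwards [ih, out_mk_eventuallyEq l fun i =>
      (N i).succ (ultraproductOut ((ultraproduct l N).evalT s t) i)] with i h h'
    exact h'.trans (congrArg _ h)
  | add t u iht ihu =>
    filter_upwards [iht, ihu, out_mk_eventuallyEq l fun i =>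
      (N i).add (ultraproductOut ((ultraproduct l N).evalT s t) i)
        (ultraproductOut ((ultraproduct l N).evalT s u) i)] with i h h' h''
    exact h''.trans (congrArg₂ _ h h')
  | mul t u iht ihu =>
    filter_upwards [iht, ihu, out_mk_eventuallyEq l fun i =>
      (N i).mul (ultraproductOut ((ultraproduct l N).evalT s t) i)
        (ultraproductOut ((ultraproduct l N).evalT s u) i)] with i h h' h''
    exact h''.trans (congrArg₂ _ h h')

/-- Łoś's theorem. -/
theorem sat_ultraproduct {φ : LFormula} :
    ∀ s : ℕ → (ultraproduct l N).U, (ultraproduct l N).Sat s φ ↔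
      ∀ᶠ i in l, (N i).Sat (fun z => ultraproductOut (s z) i) φ := by
  induction φ with
  | eq t u =>
    intro s
    have ht := out_evalT_ultraproduct l s t
    have hu := out_evalT_ultraproduct l s u
    constructor
    · intro h
      filter_upwards [ht, hu] with i ht hu
      exact ht.symm.trans ((congrArg (ultraproductOut · i) h).trans hu)
    · intro h
      refine Quotient.out_equiv_out.1 ?_
      filter_upwards [h, ht, hu] with i h ht hu
      exact ht.trans (h.trans hu.symm)
  | falsum => intro s; simp [Sat, l.neBot.ne]
  | imp a b iha ihb =>
    intro s
    simp only [Sat, iha, ihb, Ultrafilter.eventually_imp]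
  | all x a ih =>
    intro s
    simp only [Sat, ih, out_update]
    constructor
    · intro h
      by_contra hne
      rw [← Ultrafilter.eventually_not] at hne
      have : ∀ i, ∃ v, (¬ ∀ u, (N i).Sat (Function.update (fun z => ultraproductOut (s z) i) x u) a) →
          ¬ (N i).Sat (Function.update (fun z => ultraproductOut (s z) i) x v) a := fun i => by
        by_cases hi : ∀ u, (N i).Sat (Function.update (fun z => ultraproductOut (s z) i) x u) a
        · exact ⟨(N i).zero, fun h => absurd hi h⟩
        · obtain ⟨v, hv⟩ := not_forall.1 hi
          exact ⟨v, fun _ => hv⟩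
      choose f hf using this
      obtain ⟨i, hi, hi', hi''⟩ :=
        ((h (ultraproductMk l f)).and (hne.and (out_mk_eventuallyEq l f))).exists
      rw [hi''] at hi
      exact hf i hi' hi
    · intro h u
      filter_upwards [h] with i hi
      exact hi _
  | K a ih => intro s; rfl

end Ultraproduct

end LStructure

/-- The compactness theorem of the base logic. -/
theorem Consequence.exists_finset {T : Set LFormula} {φ : LFormula} (h : Consequence T φ) :
    ∃ F : Finset LFormula, ↑F ⊆ T ∧ Consequence ↑F φ := by
  classical
  by_contra! hF
  have : ∀ F : Finset T, ∃ M : LStructure, IsLStructure M ∧ (∀ σ ∈ F, M.Models σ) ∧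
      ∃ s, ¬ M.Sat s φ := fun F => by
    have := hF (F.image Subtype.val) (by simp)
    simp only [Consequence, LStructure.Models] at this
    push Not at this
    obtain ⟨M, hM, hMF, s, hs⟩ := this
    exact ⟨M, hM, fun σ hσ => hMF _ (by simpa using hσ), s, hs⟩
  choose N hN hNF s hs using this
  let l : Ultrafilter (Finset T) := .of Filter.atTop
  refine absurd (h _ (LStructure.isLStructure_ultraproduct l hN) (fun σ hσ t => ?_)
    fun z => LStructure.ultraproductMk l fun i => s i z) ?_
  · rw [LStructure.sat_ultraproduct l]
    have : ∀ᶠ F : Finset T in l, {⟨σ, hσ⟩} ⊆ F :=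
      Ultrafilter.of_le _ (Filter.eventually_ge_atTop _)
    filter_upwards [this] with F h
    exact hNF F ⟨σ, hσ⟩ (by simpa using h) _
  · rw [LStructure.sat_ultraproduct l, ← Ultrafilter.eventually_not]
    have : ∀ᶠ i in l, ∀ z ∈ φ.fv, LStructure.ultraproductOut
        (LStructure.ultraproductMk l fun i => s i z) i = s i z :=
      (Filter.eventually_all_finset _).2 fun z _ => LStructure.out_mk_eventuallyEq l _
    filter_upwards [this] with i hi
    rw [LStructure.sat_congr (hN i) hi]
    exact hs i

theorem Consequence.of_mem {T : Set LFormula} {φ : LFormula} (h : φ ∈ T) : Consequence T φ :=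
  fun _ _ hT => hT φ h

theorem Consequence.mp {T : Set LFormula} {φ ψ : LFormula} (h : Consequence T (φ.imp ψ))
    (h' : Consequence T φ) : Consequence T ψ :=
  fun M hM hT s => h M hM hT s (h' M hM hT s)

theorem consequence_uclose {T : Set LFormula} {φ : LFormula} :
    Consequence T (uclose φ) ↔ Consequence T φ := by
  simp only [Consequence, LStructure.models_uclose]

/-- The deduction theorem, for sentences. -/
theorem Consequence.imp_of_insert {T : Set LFormula} {σ φ : LFormula} (hσ : σ.fv = ∅)
    (h : Consequence (insert σ T) φ) : Consequence T (σ.imp φ) := by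
  intro M hM hT s hs
  refine h M hM ?_ s
  rintro χ (rfl | hχ)
  · exact fun t => (LStructure.sat_congr hM (by simp [hσ])).1 hs
  · exact hT χ hχ

theorem LFormula.fv_uclose (φ : LFormula) : (uclose φ).fv = ∅ := by
  have : ∀ L : List ℕ, (L.foldr LFormula.all φ).fv = φ.fv \ L.toFinset := by
    intro L
    induction L with
    | nil => simp
    | cons x L ih =>
      ext z
      simp only [List.foldr_cons, fv, ih, Finset.mem_erase, Finset.mem_sdiff, List.mem_toFinset,
        List.mem_cons]
      tauto
  simp [uclose, this]

theorem LFormula.fv_instNum (s : ℕ → ℕ) (φ : LFormula) : (instNum s φ).fv = ∅ := by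
  refine Finset.eq_empty_of_forall_notMem fun w hw => ?_
  obtain ⟨z, -, hz⟩ := mem_fv_of_mem_fv_subst hw
  simp [fv_numeral] at hz

theorem LFormula.fv_line3 {pw : LFormula} (hpw : pw.fv ⊆ {vx, vy, ve}) (n : ℕ) {φ : LFormula}
    (hφ : φ.fv ⊆ {vx}) : (line3 pw n φ).fv = ∅ := by
  have h : (subst1 ve (numeral n) (subst1 vy (numeral φ.gnum) pw)).fv ⊆ {vx} := by
    intro w hw
    obtain ⟨z, hz, hwz⟩ := mem_fv_of_mem_fv_subst hw
    split_ifs at hwz with hze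
    · simp [fv_numeral] at hwz
    · obtain ⟨v, hv, hzv⟩ := mem_fv_of_mem_fv_subst hz
      split_ifs at hzv with hvy
      · simp [fv_numeral] at hzv
      · have := hpw hv
        simp only [LTerm.fv, Finset.mem_singleton, Finset.mem_insert] at *
        grind
  simp only [line3, iffF, andF, notF, fv, Finset.union_empty]
  refine Finset.eq_empty_of_forall_notMem fun w hw => ?_
  simp only [Finset.mem_erase, Finset.mem_union] at hw
  have h1 : w ∉ φ.fv := fun h' => hw.1 (by simpa using hφ h')
  have h2 := fun h' => hw.1 (by simpa using @h w h')
  tauto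

theorem SigmaAx.fv_eq_empty {pw : LFormula} (hpw : pw.fv ⊆ {vx, vy, ve}) {n : ℕ} {χ : LFormula}
    (h : SigmaAx pw n χ) : χ.fv = ∅ := by
  induction h with
  | e1 h => obtain ⟨φ, -, rfl⟩ := h; exact LFormula.fv_uclose _
  | e2 h => obtain ⟨φ, ψ, rfl⟩ := h; exact LFormula.fv_uclose _
  | e4 h => obtain ⟨φ, rfl⟩ := h; exact LFormula.fv_uclose _
  | pa h =>
    cases h with
    | ind => exact LFormula.fv_uclose _
    | _ => decide
  | code φ h => exact LFormula.fv_line3 hpw n h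
  | av φ s h => exact LFormula.fv_instNum s φ
  | k _ ih => exact ih

theorem Consequence.K_of_finset {pw : LFormula} (hpw : pw.fv ⊆ {vx, vy, ve}) {n : ℕ}
    {F : Finset LFormula} : ∀ {φ : LFormula}, ↑F ⊆ SigmaN pw n → Consequence ↑F φ →
    Consequence (SigmaN pw n) φ.K := by
  induction F using Finset.induction_on with
  | empty =>
    intro φ _ h
    rw [Finset.coe_empty] at h
    exact consequence_uclose.1 (.of_mem (.e1 ⟨φ, h, rfl⟩))
  | insert σ F _ ih =>
    intro φ hF h
    rw [Finset.coe_insert] at hF h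
    rw [Set.insert_subset_iff] at hF
    have hE2 : Consequence (SigmaN pw n) ((σ.imp φ).K.imp (σ.K.imp φ.K)) :=
      consequence_uclose.1 (.of_mem (.e2 ⟨σ, φ, rfl⟩))
    exact (hE2.mp (ih hF.2 (h.imp_of_insert (hF.1.fv_eq_empty hpw)))).mp (.of_mem (.k hF.1))

/-- Necessitation for `Σ(n)`. -/
theorem Consequence.K {pw : LFormula} (hpw : pw.fv ⊆ {vx, vy, ve}) {n : ℕ} {φ : LFormula}
    (h : Consequence (SigmaN pw n) φ) : Consequence (SigmaN pw n) φ.K :=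
  let ⟨_, hF, h⟩ := h.exists_finset
  .K_of_finset hpw hF h

theorem LFormula.freeFor_of_fv_subset {σ : ℕ → LTerm} (h : ∀ z, (σ z).fv ⊆ {z}) (a : LFormula) :
    a.FreeFor σ :=
  freeFor_of_forall fun z _ _ hw => .inl (by simpa using h z hw)

theorem instNum_congr {s t : ℕ → ℕ} {φ : LFormula} (h : ∀ x ∈ φ.fv, s x = t x) :
    instNum s φ = instNum t φ :=
  LFormula.subst_congr fun x hx => congrArg numeral (h x hx)

theorem instNum_of_fv_eq_empty {s : ℕ → ℕ} {φ : LFormula} (h : φ.fv = ∅) : instNum s φ = φ :=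
  LFormula.subst_eq_self (by simp [h])

theorem consequence_iff_of_alphaVariant {T : Set LFormula} {φ ψ : LFormula}
    (h : AlphaVariant φ ψ) : Consequence T φ ↔ Consequence T ψ := by
  refine forall₃_congr fun M hM _ => forall_congr' fun s => ?_
  refine LStructure.sat_iff_of_formulaAlpha hM h fun x y hxy _ => ?_
  simp only [VarCorr] at hxy
  rw [hxy]

theorem instNum_subst1_var (s : ℕ → ℕ) {x y : ℕ} {φ : LFormula} (h : SubstitutableVar y x φ) :
    instNum s (subst1 x (.var y) φ) = instNum (Function.update s x (s y)) φ := by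
  rw [subst1, instNum, LFormula.subst_subst _ h.freeFor]
  refine LFormula.subst_congr fun z _ => ?_
  by_cases hzx : z = x <;> simp [hzx, LTerm.subst]

theorem isLStructure_MSigma (T : Set LFormula) : IsLStructure (MSigma T) := by
  have hfree (s : ℕ → ℕ) (φ : LFormula) : φ.FreeFor fun z => numeral (s z) :=
    LFormula.freeFor_of_fv_subset (by simp [fv_numeral]) φ
  refine ⟨fun φ s t h => ?_, fun φ ψ s h => ?_, fun φ x y s h => ?_⟩
  · exact iff_of_eq (congrArg (Consequence T) (instNum_congr h))
  · refine consequence_iff_of_alphaVariant (h.subst (hfree s φ) (hfree s ψ) fun x _ y _ hxy => ?_)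
    simp only [VarCorr] at hxy
    rw [hxy]
    exact termAlpha_of_fv_eq_empty (fv_numeral _)
  · refine iff_of_eq (congrArg (Consequence T) ?_)
    exact instNum_subst1_var s h

/-- The value of a term in the standard model of arithmetic. -/
def evalN (s : ℕ → ℕ) : LTerm → ℕ := StdModel.evalT s

@[simp]
theorem evalN_var (s : ℕ → ℕ) (x : ℕ) : evalN s (.var x) = s x := rfl

theorem evalN_congr {s t : ℕ → ℕ} {u : LTerm} (h : ∀ x ∈ u.fv, s x = t x) :
    evalN s u = evalN t u :=
  LStructure.evalT_congr (M := StdModel) h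

theorem evalN_subst (s : ℕ → ℕ) (σ : ℕ → LTerm) (t : LTerm) :
    evalN s (t.subst σ) = evalN (fun z => evalN s (σ z)) t := by
  induction t with
  | var x => rfl
  | zero => rfl
  | succ t ih => exact congrArg Nat.succ ih
  | add t u iht ihu => exact congrArg₂ (· + ·) iht ihu
  | mul t u iht ihu => exact congrArg₂ (· * ·) iht ihu

@[simp]
theorem evalN_numeral (s : ℕ → ℕ) (k : ℕ) : evalN s (numeral k) = k := by
  induction k with
  | zero => rfl
  | succ k ih => exact congrArg Nat.succ ih

/-- Satisfaction in `M_Σ`, for assignments into `ℕ`. -/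
def SatN (T : Set LFormula) (s : ℕ → ℕ) (φ : LFormula) : Prop := (MSigma T).Sat s φ

section SatN

variable {T : Set LFormula} {s : ℕ → ℕ}

theorem models_MSigma_iff {φ : LFormula} : (MSigma T).Models φ ↔ ∀ s, SatN T s φ := Iff.rfl

theorem satN_eq {t u : LTerm} : SatN T s (.eq t u) ↔ evalN s t = evalN s u := by
  have h (t : LTerm) : (MSigma T).evalT s t = evalN s t := by
    induction t with
    | var x => rfl
    | zero => rfl
    | succ t ih => exact congrArg Nat.succ ih
    | add t u iht ihu => exact congrArg₂ (· + ·) iht ihu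
    | mul t u iht ihu => exact congrArg₂ (· * ·) iht ihu
  exact iff_of_eq (congrArg₂ (· = ·) (h t) (h u))

theorem satN_imp {φ ψ : LFormula} : SatN T s (.imp φ ψ) ↔ (SatN T s φ → SatN T s ψ) := Iff.rfl

theorem satN_all {x : ℕ} {φ : LFormula} :
    SatN T s (.all x φ) ↔ ∀ k, SatN T (Function.update s x k) φ := Iff.rfl

theorem satN_K {φ : LFormula} : SatN T s φ.K ↔ Consequence T (instNum s φ) := Iff.rfl

theorem satN_iffF {φ ψ : LFormula} : SatN T s (iffF φ ψ) ↔ (SatN T s φ ↔ SatN T s ψ) := by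
  have : SatN T s (iffF φ ψ) ↔
      (((SatN T s φ → SatN T s ψ) → (SatN T s ψ → SatN T s φ) → False) → False) := Iff.rfl
  tauto

theorem satN_congr {t : ℕ → ℕ} {φ : LFormula} (h : ∀ x ∈ φ.fv, s x = t x) :
    SatN T s φ ↔ SatN T t φ :=
  LStructure.sat_congr (isLStructure_MSigma T) h

end SatN

/-- A substitution of terms of the form `S⋯S0` or `S⋯Sz` for the variables `z`. -/
def IsNumeralSubst (σ : ℕ → LTerm) : Prop :=
  ∀ z, (σ z).fv ⊆ {z} ∧ ∀ s : ℕ → ℕ,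
    (σ z).subst (fun w => numeral (s w)) = numeral (evalN s (σ z))

theorem isNumeralSubst_numeral (s : ℕ → ℕ) : IsNumeralSubst fun z => numeral (s z) :=
  fun z => by simp [fv_numeral, subst_numeral]

theorem isNumeralSubst_subst1 {x : ℕ} {t : LTerm} (ht : t.fv ⊆ {x})
    (ht' : ∀ s : ℕ → ℕ, t.subst (fun w => numeral (s w)) = numeral (evalN s t)) :
    IsNumeralSubst fun z => if z = x then t else LTerm.var z := by
  intro z
  by_cases h : z = x
  · subst h
    simpa only [if_true] using And.intro ht ht'
  · simp [h, LTerm.fv, LTerm.subst]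

theorem satN_subst (T : Set LFormula) {φ : LFormula} : ∀ {σ : ℕ → LTerm} (s : ℕ → ℕ),
    IsNumeralSubst σ → (SatN T s (φ.subst σ) ↔ SatN T (fun z => evalN s (σ z)) φ) := by
  induction φ with
  | eq t u =>
    intro σ s h
    simp only [LFormula.subst, satN_eq, evalN_subst]
  | falsum => intros; rfl
  | imp a b iha ihb => exact fun s h => imp_congr (iha s h) (ihb s h)
  | all x a ih =>
    intro σ s h
    rw [LFormula.subst, satN_all, satN_all]
    refine forall_congr' fun k => (ih _ fun z => ?_).trans ?_
    · split_ifs with hzx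
      · subst hzx
        exact ⟨by simp [LTerm.fv], fun s => rfl⟩
      · exact h z
    · refine satN_congr fun z _ => ?_
      by_cases hzx : z = x
      · subst hzx
        simp
      · rw [if_neg hzx, Function.update_of_ne hzx]
        refine evalN_congr fun w hw => ?_
        have : w = z := by simpa using (h z).1 hw
        rw [this, Function.update_of_ne hzx]
  | K a ih =>
    intro σ s h
    refine iff_of_eq (congrArg (Consequence T) ?_)
    rw [instNum, LFormula.subst_subst _ (LFormula.freeFor_of_fv_subset (fun z => (h z).1) a)]
    exact LFormula.subst_congr fun z _ => (h z).2 s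

theorem satN_instNum (T : Set LFormula) (s t : ℕ → ℕ) (φ : LFormula) :
    SatN T s (instNum t φ) ↔ SatN T t φ := by
  rw [instNum, satN_subst T s (isNumeralSubst_numeral t)]
  simp only [evalN_numeral]

theorem satN_subst1 (T : Set LFormula) (s : ℕ → ℕ) {x : ℕ} {t : LTerm} (φ : LFormula)
    (ht : t.fv ⊆ {x})
    (ht' : ∀ s : ℕ → ℕ, t.subst (fun w => numeral (s w)) = numeral (evalN s t)) :
    SatN T s (subst1 x t φ) ↔ SatN T (Function.update s x (evalN s t)) φ := by
  rw [subst1, satN_subst T s (isNumeralSubst_subst1 ht ht')]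
  refine satN_congr fun z _ => ?_
  by_cases h : z = x <;> simp [h]

theorem satN_subst1_numeral (T : Set LFormula) (s : ℕ → ℕ) (x k : ℕ) (φ : LFormula) :
    SatN T s (subst1 x (numeral k) φ) ↔ SatN T (Function.update s x k) φ := by
  rw [satN_subst1 T s φ (by simp [fv_numeral])
    fun s => by rw [subst_numeral, evalN_numeral], evalN_numeral]

theorem satN_subst1_succ (T : Set LFormula) (s : ℕ → ℕ) (x : ℕ) (φ : LFormula) :
    SatN T s (subst1 x (.succ (.var x)) φ) ↔ SatN T (Function.update s x (s x + 1)) φ :=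
  satN_subst1 T s φ (by simp [LTerm.fv]) fun _ => rfl

theorem KFree.satN_iff (T : Set LFormula) {φ : LFormula} : ∀ s : ℕ → ℕ, KFree φ →
    (SatN T s φ ↔ StdModel.Sat s φ) := by
  induction φ with
  | eq t u => exact fun s _ => satN_eq
  | falsum => intros; rfl
  | imp a b iha ihb => exact fun s h => imp_congr (iha s h.1) (ihb s h.2)
  | all x a ih => exact fun s h => forall_congr' fun u => ih _ h
  | K a => exact fun s h => h.elim

theorem KFree.subst {φ : LFormula} : ∀ (σ : ℕ → LTerm), KFree φ → KFree (φ.subst σ) := by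
  induction φ with
  | imp a b iha ihb => exact fun σ h => ⟨iha σ h.1, ihb σ h.2⟩
  | all x a ih => exact fun σ h => ih _ h
  | _ => exact fun σ h => h

theorem satN_ind (T : Set LFormula) (s : ℕ → ℕ) (x : ℕ) (φ : LFormula)
    (h0 : SatN T s (subst1 x .zero φ))
    (hS : SatN T s (.all x (.imp φ (subst1 x (.succ (.var x)) φ)))) : SatN T s (.all x φ) := by
  rw [satN_all] at hS ⊢
  intro k
  induction k with
  | zero => exact (satN_subst1_numeral T s x 0 φ).1 h0
  | succ k ih => simpa using (satN_subst1_succ T _ x φ).1 (satN_imp.1 (hS k) ih)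

theorem PAax.models_MSigma (T : Set LFormula) {χ : LFormula} (h : PAax χ) :
    (MSigma T).Models χ := by
  cases h with
  | ind φ x =>
    rw [LStructure.models_uclose]
    exact fun s h0 hS => satN_ind T s x φ h0 hS
  | succ_ne_zero => exact fun s u => Nat.succ_ne_zero u
  | succ_inj => exact fun s u v => Nat.succ.inj
  | add_zero => exact fun s u => rfl
  | add_succ => exact fun s u v => rfl
  | mul_zero => exact fun s u => rfl
  | mul_succ => exact fun s u v => rfl

theorem mem_goalSet {pw φ : LFormula} {n m : ℕ} (hφ : φ.fv ⊆ {vx}) :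
    Nat.pair m φ.gnum ∈ goalSet pw n ↔
      Consequence (SigmaN pw n) (subst1 vx (numeral m) φ) := by
  constructor
  · rintro ⟨m', φ', h, -, h'⟩
    obtain ⟨rfl, hφ'⟩ := Nat.pair_eq_pair.1 h
    rwa [LFormula.gnum_injective hφ']
  · exact fun h => ⟨m, φ, rfl, hφ, h⟩

theorem models_line3_MSigma {pw : LFormula} (hpw : pw.fv ⊆ {vx, vy, ve}) (hkf : KFree pw)
    (hcorr : ∀ a b k : ℕ, StdModel.Models (pwNum pw a b k) ↔ Nat.pair a b ∈ W k)
    {n : ℕ} (hW : W n = goalSet pw n) {φ : LFormula} (hφ : φ.fv ⊆ {vx}) :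
    (MSigma (SigmaN pw n)).Models (line3 pw n φ) := by
  have hinst (s : ℕ → ℕ) (m : ℕ) :
      instNum (Function.update s vx m) φ = subst1 vx (numeral m) φ :=
    LFormula.subst_congr fun z hz => by
      have : z = vx := by simpa using hφ hz
      simp [this]
  rw [models_MSigma_iff]
  intro s
  rw [line3, satN_all]
  intro m
  rw [satN_iffF, satN_subst1_numeral, satN_subst1_numeral, satN_K, hinst]
  have hstd : StdModel.Models (pwNum pw m φ.gnum n) ↔ SatN (SigmaN pw n)
      (fun z => if z = vx then m else if z = vy then φ.gnum else n) pw := by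
    refine ⟨fun h => ?_, fun h s => ?_⟩
    · exact (satN_instNum _ (fun _ => 0) _ _).1 ((KFree.satN_iff _ _ (hkf.subst _)).2 (h _))
    · exact (KFree.satN_iff _ s (hkf.subst _)).1 ((satN_instNum _ s _ _).2 h)
  rw [← mem_goalSet hφ, ← hW, ← hcorr, hstd]
  refine satN_congr fun z hz => ?_
  have := hpw hz
  simp only [vx, vy, ve, Finset.mem_insert, Finset.mem_singleton] at this ⊢
  rcases this with rfl | rfl | rfl <;> simp

theorem models_SigmaN_MSigma {pw : LFormula} (hpw : pw.fv ⊆ {vx, vy, ve}) (hkf : KFree pw)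
    (hcorr : ∀ a b k : ℕ, StdModel.Models (pwNum pw a b k) ↔ Nat.pair a b ∈ W k)
    {n : ℕ} (hW : W n = goalSet pw n) {χ : LFormula} (h : SigmaAx pw n χ) :
    (MSigma (SigmaN pw n)).Models χ := by
  cases h with
  | e1 h =>
    obtain ⟨φ, hφ, rfl⟩ := h
    exact LStructure.models_uclose.2 fun s => .of_mem (.av φ s hφ)
  | e2 h =>
    obtain ⟨φ, ψ, rfl⟩ := h
    exact LStructure.models_uclose.2 fun s h h' => Consequence.mp h h'
  | e4 h =>
    obtain ⟨φ, rfl⟩ := h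
    exact LStructure.models_uclose.2 fun s h => Consequence.K hpw h
  | pa h => exact h.models_MSigma _
  | code φ h => exact models_line3_MSigma hpw hkf hcorr hW h
  | av φ s h =>
    exact fun t => (satN_instNum _ t s φ).2
      (h _ (isLStructure_MSigma _) (by simp) s)
  | @k φ h =>
    rw [models_MSigma_iff]
    intro s
    rw [satN_K, instNum_of_fv_eq_empty (h.fv_eq_empty hpw)]
    exact .of_mem h

theorem models_E3_MSigma {T : Set LFormula} (hT : ∀ χ ∈ T, (MSigma T).Models χ) {χ : LFormula}
    (h : χ ∈ E3set) : (MSigma T).Models χ := by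
  obtain ⟨φ, rfl⟩ := h
  exact LStructure.models_uclose.2 fun s (h : Consequence T (instNum s φ)) =>
    (satN_instNum T s s φ).1 (h _ (isLStructure_MSigma T) hT s)

/-- Let n satisfy W_n = { ⟨m, ⌜φ⌝⟩ : φ with free variables ⊆ {x} and
Σ(n) ⊨ φ(x|m̄) }.  Then M_(Σ(n)) satisfies all the axioms of epistemic arithmetic mod
factivity, and moreover satisfies all instances of E3 (the universal closure of
K φ → φ); in particular it satisfies all of these axioms of epistemic arithmetic
together. -/
theorem MSigmaN_epistemic_arithmetic_mod_factivity (pw : LFormula) (hfv : pw.fv ⊆ {vx, vy, ve}) (hkf : KFree pw)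
    (hcorr : ∀ a b k : ℕ, StdModel.Models (pwNum pw a b k) ↔ Nat.pair a b ∈ W k)
    (n : ℕ) (hW : W n = goalSet pw n) :
    (∀ χ ∈ EAmodFact, (MSigma (SigmaN pw n)).Models χ) ∧
    (∀ χ ∈ E3set, (MSigma (SigmaN pw n)).Models χ) ∧
    (∀ χ ∈ EAmodFact ∪ E3set, (MSigma (SigmaN pw n)).Models χ) := by
  have hS : ∀ χ ∈ SigmaN pw n, (MSigma (SigmaN pw n)).Models χ := fun χ h =>
    models_SigmaN_MSigma hfv hkf hcorr hW h
  have hE3 : ∀ χ ∈ E3set, (MSigma (SigmaN pw n)).Models χ := fun χ h => models_E3_MSigma hS h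
  have hEA : ∀ χ ∈ EAmodFact, (MSigma (SigmaN pw n)).Models χ := by
    rintro χ ((((h | h) | h) | h) | ⟨φ, ((h | h) | h) | h, rfl⟩)
    · exact hS χ (.e1 h)
    · exact hS χ (.e2 h)
    · exact hE3 χ h
    · exact hS χ (.e4 h)
    · exact hS _ (.k (.e1 h))
    · exact hS _ (.k (.e2 h))
    · exact hS _ (.k (.e4 h))
    · exact hS _ (.k (.pa h))
  exact ⟨hEA, hE3, fun χ h => h.elim (hEA χ) (hE3 χ)⟩
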